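/- There is an absolute constant C with the following property. Let Q ∈ C¹(ℝ³; ℝ³) with ‖Q‖_{ℓ²(ℤ⁺),L∞} < ∞ and set V := div Q. Let r ≥ 1 and let μ be a C¹ complex-valued function on {x : |x| ≥ r}; set m(ρ) := ρ^{−2} ∫_{|x|=ρ} |μ|² dσ_x, A(r) := ∫_{|x|>r} |∇μ(x)|²/|x|² dx, and M(r) := sup_{ρ>r} ∫_ρ^{ρ+1} m(t) dt, and assume A(r) < ∞ and M(r) < ∞. Then for every R > r + 1: | ∫_{r<|x|<R} V(x) |μ(x)|²/|x|² dx | ≤ C ‖Q‖_{ℓ²([r],∞),L∞} ( m(r) + m(R) + √(A(r) M(r)) + M(r) (r+1)^{−1/2} ). -/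

import Mathlib

open MeasureTheory Metric

noncomputable section

/-- Divergence of a real vector field on `ℝ³`. -/
def rdiv (Q : EuclideanSpace ℝ (Fin 3) → EuclideanSpace ℝ (Fin 3))
    (x : EuclideanSpace ℝ (Fin 3)) : ℝ :=
  ∑ i : Fin 3, fderiv ℝ (fun y => Q y i) x (EuclideanSpace.single i 1)

/-- `sup_{n < |x| < n+1} |Q(x)|` for a vector field `Q`. -/
def annSupV (Q : EuclideanSpace ℝ (Fin 3) → EuclideanSpace ℝ (Fin 3)) (n : ℕ) : ℝ :=
  sSup ((fun x => ‖Q x‖) '' {x : EuclideanSpace ℝ (Fin 3) | (n : ℝ) < ‖x‖ ∧ ‖x‖ < (n : ℝ) + 1})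

/-- The tail norm `‖Q‖_{ℓ²([r],∞),L∞}`, with `[r]` the integer part of `r`. -/
def l2LinfTail (Q : EuclideanSpace ℝ (Fin 3) → EuclideanSpace ℝ (Fin 3)) (r : ℝ) : ℝ :=
  Real.sqrt (∑' n : ℕ, (annSupV Q (Nat.floor r + n)) ^ 2)

/-- `m(ρ) = ρ⁻² ∫_{|x|=ρ} |μ|² dσ`. -/
def sphAvg (μ : EuclideanSpace ℝ (Fin 3) → ℂ) (ρ : ℝ) : ℝ :=
  (ρ ^ 2)⁻¹ * ∫ x in sphere (0 : EuclideanSpace ℝ (Fin 3)) ρ, ‖μ x‖ ^ 2 ∂μH[2]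

/-- `A(r) = ∫_{|x|>r} |∇μ|²/|x|² dx`. -/
def Aint (μ : EuclideanSpace ℝ (Fin 3) → ℂ) (r : ℝ) : ℝ :=
  ∫ x in {x : EuclideanSpace ℝ (Fin 3) | r < ‖x‖}, ‖fderiv ℝ μ x‖ ^ 2 / ‖x‖ ^ 2

/-- The set of values `∫_ρ^{ρ+1} m(t) dt` for `ρ > r`, whose supremum is `M(r)`. -/
def Mset (μ : EuclideanSpace ℝ (Fin 3) → ℂ) (r : ℝ) : Set ℝ :=
  {y : ℝ | ∃ ρ : ℝ, r < ρ ∧ y = ∫ t in ρ..(ρ + 1), sphAvg μ t}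

/-- `M(r) = sup_{ρ>r} ∫_ρ^{ρ+1} m(t) dt`. -/
def Msup (μ : EuclideanSpace ℝ (Fin 3) → ℂ) (r : ℝ) : ℝ := sSup (Mset μ r)

end

section Aux
open Set Filter Topology ENNReal
open scoped Pointwise

abbrev E3 := EuclideanSpace ℝ (Fin 3)

lemma sphere_sub_image :
    sphere (0 : E3) 1 ⊆ (fun p : ℝ × ℝ =>
      (!₂[Real.sin p.1 * Real.cos p.2, Real.sin p.1 * Real.sin p.2, Real.cos p.1] : E3)) ''
      (Icc (-4) 4 ×ˢ Icc (-4) 4) := by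
  intro x hx
  have h1 : x 0 ^ 2 + x 1 ^ 2 + x 2 ^ 2 = 1 := by
    have : ‖x‖ = 1 := by simpa using hx
    have h2 := EuclideanSpace.norm_sq_eq x
    rw [this, Fin.sum_univ_three] at h2
    simpa using h2.symm
  have hz1 : -1 ≤ x 2 := by nlinarith [sq_nonneg (x 0), sq_nonneg (x 1)]
  have hz2 : x 2 ≤ 1 := by nlinarith [sq_nonneg (x 0), sq_nonneg (x 1)]
  have hs : Real.sin (Real.arccos (x 2)) = ‖(⟨x 0, x 1⟩ : ℂ)‖ := by
    rw [Real.sin_arccos, Complex.norm_def, Complex.normSq_mk]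
    congr 1; linarith
  refine ⟨(Real.arccos (x 2), Complex.arg ⟨x 0, x 1⟩), ⟨⟨?_, ?_⟩, ?_, ?_⟩, ?_⟩
  · linarith [Real.arccos_nonneg (x 2)]
  · linarith [Real.arccos_le_pi (x 2), Real.pi_le_four]
  · linarith [Complex.neg_pi_lt_arg ⟨x 0, x 1⟩, Real.pi_le_four]
  · linarith [Complex.arg_le_pi ⟨x 0, x 1⟩, Real.pi_le_four]
  · ext i
    fin_cases i
    · simp [hs, Complex.norm_mul_cos_arg]
    · simp [hs, Complex.norm_mul_sin_arg]
    · simp [Real.cos_arccos hz1 hz2]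

lemma hausdorff_sphere_lt_top : μH[2] (sphere (0 : E3) 1) < ∞ := by
  have hc : ContDiff ℝ 1 (fun p : ℝ × ℝ =>
      (!₂[Real.sin p.1 * Real.cos p.2, Real.sin p.1 * Real.sin p.2, Real.cos p.1] : E3)) := by
    rw [contDiff_euclidean]
    intro i
    fin_cases i <;> simp <;> fun_prop
  have hK : IsCompact (Icc (-4 : ℝ) 4 ×ˢ Icc (-4 : ℝ) 4) := isCompact_Icc.prod isCompact_Icc
  obtain ⟨K, hl⟩ := (hc.locallyLipschitz.locallyLipschitzOn
    (s := Icc (-4 : ℝ) 4 ×ˢ Icc (-4 : ℝ) 4)).exists_lipschitzOnWith_of_compact hK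
  refine (measure_mono sphere_sub_image).trans_lt ?_
  refine (hl.hausdorffMeasure_image_le (by norm_num : (0 : ℝ) ≤ 2)).trans_lt ?_
  rw [hausdorffMeasure_prod_real]
  exact ENNReal.mul_lt_top (by simp) hK.measure_lt_top

instance : IsFiniteMeasure (μH[2] : Measure (sphere (0 : E3) 1)) := by
  constructor
  rw [← isometry_subtype_coe.hausdorffMeasure_image (Or.inl (by norm_num))]
  rw [image_univ, Subtype.range_coe]
  exact hausdorff_sphere_lt_top

lemma toSphere_closedBall_le (x : sphere (0 : E3) 1) (d : ℝ) (hd : 0 < d) (hd1 : d ≤ 1) :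
    (volume : Measure E3).toSphere (closedBall x d) ≤
      (48 * volume (closedBall (0 : E3) 1)) * ENNReal.ofReal d ^ 2 := by
  rw [Measure.toSphere_apply' _ measurableSet_closedBall]
  have hsub : Ioo (0 : ℝ) 1 • ((↑) '' (closedBall x d) : Set E3) ⊆
      ⋃ k ∈ Finset.range (⌊1 / d⌋₊ + 1), closedBall (((k : ℝ) * d) • (x : E3)) (2 * d) := by
    rintro _ ⟨t, ht, _, ⟨w, hw, rfl⟩, rfl⟩
    have hk : (⌊t / d⌋₊ : ℝ) ≤ t / d := Nat.floor_le (div_nonneg ht.1.le hd.le)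
    have hk2 : t / d < ⌊t / d⌋₊ + 1 := Nat.lt_floor_add_one _
    rw [le_div_iff₀ hd] at hk
    rw [div_lt_iff₀ hd] at hk2
    simp only [mem_iUnion, Finset.mem_range]
    refine ⟨⌊t / d⌋₊, ?_, ?_⟩
    · apply Nat.lt_succ_of_le
      apply Nat.floor_le_floor
      gcongr
      exact ht.2.le
    · rw [mem_closedBall, dist_eq_norm]
      have hx : ‖(x : E3)‖ = 1 := by simpa using x.2
      have hw' : ‖(w : E3) - x‖ ≤ d := by
        rw [mem_closedBall, Subtype.dist_eq, dist_eq_norm] at hw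
        exact hw
      have e : t • (w : E3) - ((⌊t / d⌋₊ : ℝ) * d) • (x : E3) =
          t • ((w : E3) - x) + (t - (⌊t / d⌋₊ : ℝ) * d) • (x : E3) := by module
      show ‖t • (w : E3) - ((⌊t / d⌋₊ : ℝ) * d) • (x : E3)‖ ≤ 2 * d
      rw [e]
      refine (norm_add_le _ _).trans ?_
      rw [norm_smul, norm_smul, hx, Real.norm_of_nonneg ht.1.le, Real.norm_of_nonneg (by linarith)]
      nlinarith [ht.1, ht.2, norm_nonneg ((w : E3) - x)]
  have hvol : volume (Ioo (0 : ℝ) 1 • ((↑) '' (closedBall x d) : Set E3)) ≤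
      ENNReal.ofReal (2 / d) * (ENNReal.ofReal ((2 * d) ^ 3) * volume (closedBall (0 : E3) 1)) := by
    refine (measure_mono hsub).trans ((measure_biUnion_finset_le _ _).trans ?_)
    have : ∀ k : ℕ, volume (closedBall (((k : ℝ) * d) • (x : E3)) (2 * d)) =
        ENNReal.ofReal ((2 * d) ^ 3) * volume (closedBall (0 : E3) 1) := by
      intro k
      rw [Measure.addHaar_closedBall' _ _ (by positivity)]
      simp
    simp only [this, Finset.sum_const, Finset.card_range, nsmul_eq_mul]
    gcongr
    rw [← ENNReal.ofReal_natCast]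
    apply ENNReal.ofReal_le_ofReal
    push_cast
    have := Nat.floor_le (show 0 ≤ 1 / d by positivity)
    have h2 : 1 ≤ 1 / d := by rw [le_div_iff₀ hd]; linarith
    calc _ ≤ 1 / d + 1 / d := by linarith
      _ = 2 / d := by ring
  calc _ ≤ (3 : ℝ≥0∞) * (ENNReal.ofReal (2 / d) * (ENNReal.ofReal ((2 * d) ^ 3) * volume (closedBall (0 : E3) 1))) := by
        simp only [finrank_euclideanSpace, Fintype.card_fin]
        push_cast
        gcongr
    _ = (ENNReal.ofReal (3 * (2 / d) * (2 * d) ^ 3)) * volume (closedBall (0 : E3) 1) := by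
        rw [ENNReal.ofReal_mul (by positivity), ENNReal.ofReal_mul (by positivity)]
        simp only [ENNReal.ofReal_ofNat]
        ring
    _ = ENNReal.ofReal (48 * d ^ 2) * volume (closedBall (0 : E3) 1) := by
        congr 2; field_simp; ring
    _ = _ := by
        rw [ENNReal.ofReal_mul (by positivity), ENNReal.ofReal_pow hd.le]
        simp only [ENNReal.ofReal_ofNat]
        ring

lemma toSphere_le : ∃ C : ℝ≥0∞, C ≠ 0 ∧ C ≠ ∞ ∧
    (volume : Measure E3).toSphere ≤ C • (μH[2] : Measure (sphere (0 : E3) 1)) := by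
  set C : ℝ≥0∞ := 48 * volume (closedBall (0 : E3) 1) with hC
  have hC0 : C ≠ 0 := by
    have : 0 < volume (closedBall (0 : E3) 1) := measure_closedBall_pos _ _ (by norm_num)
    rw [hC]; exact mul_ne_zero (by norm_num) this.ne'
  have hC1 : C ≠ ∞ := ENNReal.mul_ne_top (by simp) measure_closedBall_lt_top.ne
  refine ⟨C, hC0, hC1, ?_⟩
  have key : C⁻¹ • (volume : Measure E3).toSphere ≤ μH[2] := by
    apply Measure.le_hausdorffMeasure 2 _ 1 (by norm_num)
    intro s hs
    rw [Measure.smul_apply, smul_eq_mul, ENNReal.inv_mul_le_iff hC0 hC1]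
    rcases s.eq_empty_or_nonempty with rfl | ⟨x, hx⟩
    · simp
    have hne : ediam s ≠ ∞ := (hs.trans_lt (by simp)).ne
    set δ := (ediam s).toReal with hδ
    have hδe : ediam s = ENNReal.ofReal δ := (ENNReal.ofReal_toReal hne).symm
    have hδ1 : δ ≤ 1 := by
      have := ENNReal.toReal_mono (by simp) hs
      simpa using this
    have hδ0 : 0 ≤ δ := ENNReal.toReal_nonneg
    have hb : ∀ d, δ ≤ d → s ⊆ closedBall x d := by
      intro d hd y hy
      rw [mem_closedBall, dist_edist]
      exact (ENNReal.toReal_mono hne (edist_le_ediam_of_mem hy hx)).trans hd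
    rw [hδe, ENNReal.rpow_two]
    rcases hδ0.eq_or_lt with h0 | h0
    · rw [← h0]
      have ht : Tendsto (fun d : ℝ => C * ENNReal.ofReal d ^ 2) (𝓝[>] 0) (𝓝 (C * ENNReal.ofReal 0 ^ 2)) := by
        apply Tendsto.mono_left _ nhdsWithin_le_nhds
        apply ENNReal.Tendsto.const_mul _ (Or.inr hC1)
        have : Continuous (fun d : ℝ => ENNReal.ofReal d ^ 2) :=
          (ENNReal.continuous_pow 2).comp ENNReal.continuous_ofReal
        exact this.tendsto 0
      refine ge_of_tendsto ht ?_
      filter_upwards [Ioc_mem_nhdsGT (show (0 : ℝ) < 1 by norm_num)] with d hd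
      exact (measure_mono (hb d (by rw [← h0]; exact hd.1.le))).trans (toSphere_closedBall_le x d hd.1 hd.2)
    · exact (measure_mono (hb δ le_rfl)).trans (toSphere_closedBall_le x δ h0 hδ1)
  intro s
  have := key s
  rw [Measure.smul_apply, smul_eq_mul, ENNReal.inv_mul_le_iff hC0 hC1] at this
  exact this


lemma restrict_sphere_eq (ρ : ℝ) (hρ : 0 < ρ) :
    (μH[2] : Measure E3).restrict (sphere (0 : E3) ρ) =
      (ENNReal.ofReal (ρ ^ 2)) • Measure.map (fun ω : sphere (0 : E3) 1 => ρ • (ω : E3)) μH[2] := by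
  ext s hs
  have hm : Measurable (fun ω : sphere (0 : E3) 1 => ρ • (ω : E3)) := by
    fun_prop
  have hi : Isometry (Subtype.val : sphere (0 : E3) 1 → E3) := isometry_subtype_coe
  rw [Measure.restrict_apply hs, Measure.smul_apply, Measure.map_apply hm hs,
    ← hi.hausdorffMeasure_image (Or.inl (by norm_num : (0 : ℝ) ≤ 2))]
  have e : s ∩ sphere (0 : E3) ρ = ρ • (Subtype.val '' ((fun ω : sphere (0 : E3) 1 => ρ • (ω : E3)) ⁻¹' s)) := by
    ext x
    constructor
    · rintro ⟨hx, hx2⟩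
      have hn : ‖x‖ = ρ := by simpa using hx2
      refine ⟨ρ⁻¹ • x, ⟨⟨ρ⁻¹ • x, ?_⟩, ?_, rfl⟩, ?_⟩
      · simp [norm_smul, hn, abs_of_pos hρ, hρ.ne']
      · simpa [smul_smul, hρ.ne'] using hx
      · simp [smul_smul, hρ.ne']
    · rintro ⟨_, ⟨w, hw, rfl⟩, rfl⟩
      have hw1 : ‖(w : E3)‖ = 1 := by simp
      refine ⟨hw, ?_⟩
      simp [norm_smul, hw1, abs_of_pos hρ]
  rw [e, Measure.hausdorffMeasure_smul₀ (by norm_num) hρ.ne']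
  rw [ENNReal.smul_def, smul_eq_mul, smul_eq_mul]
  congr 1
  rw [ENNReal.ofReal, ENNReal.coe_inj]
  ext
  simp [abs_of_pos hρ, sq_nonneg]

lemma sphAvg_eq (μ : E3 → ℂ) (ρ : ℝ) (hρ : 0 < ρ) :
    sphAvg μ ρ = ∫ ω : sphere (0 : E3) 1, ‖μ (ρ • (ω : E3))‖ ^ 2 ∂μH[2] := by
  have hme : MeasurableEmbedding (fun ω : sphere (0 : E3) 1 => ρ • (ω : E3)) :=
    (Homeomorph.smulOfNeZero (α := E3) ρ hρ.ne').measurableEmbedding.comp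
      (MeasurableEmbedding.subtype_coe isClosed_sphere.measurableSet)
  rw [sphAvg, restrict_sphere_eq ρ hρ, integral_smul_measure, hme.integral_map,
    ENNReal.toReal_ofReal (by positivity), smul_eq_mul, ← mul_assoc,
    inv_mul_cancel₀ (by positivity), one_mul]

lemma sphAvg_nonneg (μ : E3 → ℂ) (ρ : ℝ) : 0 ≤ sphAvg μ ρ := by
  unfold sphAvg
  exact mul_nonneg (by positivity) (integral_nonneg fun _ => by positivity)

lemma cont_sph {r : ℝ} (hr : 1 ≤ r) {μ : E3 → ℂ} (hμ : ContinuousOn μ {x : E3 | r ≤ ‖x‖}) :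
    Continuous (fun p : ℝ × sphere (0 : E3) 1 => ‖μ ((max r p.1) • (p.2 : E3))‖ ^ 2) := by
  have : Continuous (fun p : ℝ × sphere (0 : E3) 1 => μ ((max r p.1) • (p.2 : E3))) := by
    refine hμ.comp_continuous (by fun_prop) ?_
    intro p
    have h2 : ‖(p.2 : E3)‖ = 1 := by simp
    simp only [mem_ofPred_eq, norm_smul, h2, mul_one]
    exact (le_max_left _ _).trans (le_abs_self _)
  exact this.norm.pow 2

lemma sphAvg_continuousOn {r : ℝ} (hr : 1 ≤ r) {μ : E3 → ℂ}
    (hμ : ContinuousOn μ {x : E3 | r ≤ ‖x‖}) : ContinuousOn (sphAvg μ) (Ici r) := by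
  have h := continuous_parametric_integral_of_continuous
    (f := fun t (ω : sphere (0 : E3) 1) => ‖μ ((max r t) • (ω : E3))‖ ^ 2)
    (μ := μH[2]) (by exact cont_sph hr hμ) (s := univ) isCompact_univ
  refine h.continuousOn.congr ?_
  intro t ht
  have ht' : r ≤ t := ht
  simp only [Measure.restrict_univ, max_eq_right ht']
  exact sphAvg_eq μ t (by linarith)

lemma polar_lintegral_le {C : ℝ≥0∞}
    (hC : (volume : Measure E3).toSphere ≤ C • (μH[2] : Measure (sphere (0 : E3) 1)))
    (f : E3 → ℝ≥0∞) (hf : Measurable f) :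
    ∫⁻ x, f x ≤ C * ∫⁻ t in Ioi (0 : ℝ), ENNReal.ofReal (t ^ 2) *
      ∫⁻ ω : sphere (0 : E3) 1, f (t • (ω : E3)) ∂μH[2] := by
  have hmp := (volume : Measure E3).measurePreserving_homeomorphUnitSphereProd
  have e1 : ∫⁻ x, f x = ∫⁻ x : ({(0 : E3)}ᶜ : Set E3), f x.1 ∂(volume.comap Subtype.val) := by
    rw [lintegral_subtype_comap (measurableSet_singleton _).compl, restrict_compl_singleton]
  have hmeas : Measurable (fun p : sphere (0 : E3) 1 × Ioi (0 : ℝ) => f (p.2.1 • p.1.1)) := by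
    fun_prop
  have e2 : ∫⁻ x : ({(0 : E3)}ᶜ : Set E3), f x.1 ∂(volume.comap Subtype.val) =
      ∫⁻ p : sphere (0 : E3) 1 × Ioi (0 : ℝ), f (p.2.1 • p.1.1)
        ∂((volume : Measure E3).toSphere.prod (Measure.volumeIoiPow (Module.finrank ℝ E3 - 1))) := by
    rw [← hmp.lintegral_comp hmeas]
    apply lintegral_congr
    intro x
    have hx : ‖(x : E3)‖ ≠ 0 := norm_ne_zero_iff.2 x.2
    simp [smul_smul, hx]
  rw [e1, e2, lintegral_prod_symm' _ hmeas]
  have e3 : Module.finrank ℝ E3 - 1 = 2 := by simp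
  rw [e3, Measure.volumeIoiPow, lintegral_withDensity_eq_lintegral_mul _ (by fun_prop)
    hmeas.lintegral_prod_left']
  simp only [Pi.mul_apply]
  rw [lintegral_subtype_comap measurableSet_Ioi (fun t : ℝ => ENNReal.ofReal (t ^ 2) *
    ∫⁻ x : sphere (0 : E3) 1, f (t • (x : E3)) ∂(volume : Measure E3).toSphere)]
  have hm2 : Measurable (fun t : ℝ => ENNReal.ofReal (t ^ 2) *
      ∫⁻ ω : sphere (0 : E3) 1, f (t • (ω : E3)) ∂μH[2]) := by
    apply Measurable.mul (by fun_prop)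
    have : Measurable (fun p : sphere (0 : E3) 1 × ℝ => f (p.2 • p.1.1)) := by fun_prop
    exact this.lintegral_prod_left'
  rw [← lintegral_const_mul _ hm2]
  apply lintegral_mono
  intro t
  simp only
  rw [mul_left_comm]
  gcongr
  calc _ ≤ ∫⁻ ω : sphere (0 : E3) 1, f (t • (ω : E3)) ∂(C • μH[2]) := lintegral_mono' hC le_rfl
    _ = _ := by rw [lintegral_smul_measure]; rfl

lemma shell_meas (a b : ℝ) : MeasurableSet {x : E3 | a < ‖x‖ ∧ ‖x‖ < b} :=
  ((isOpen_lt continuous_const continuous_norm).inter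
    (isOpen_lt continuous_norm continuous_const)).measurableSet

lemma shell_integrableOn {r : ℝ} (a b : ℝ) (hra : r ≤ a) {F : Type*} [NormedAddCommGroup F] {f : E3 → F}
    (hf : ContinuousOn f {x : E3 | r ≤ ‖x‖}) : IntegrableOn f {x : E3 | a < ‖x‖ ∧ ‖x‖ < b} := by
  have hc : IsCompact ({x : E3 | r ≤ ‖x‖} ∩ closedBall 0 b) :=
    (isCompact_closedBall _ _).inter_left (isClosed_le continuous_const continuous_norm)
  refine ((hf.mono inter_subset_left).integrableOn_compact hc).mono_set ?_
  intro x hx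
  exact ⟨hra.trans hx.1.le, by simpa using hx.2.le⟩

lemma G_cont {r : ℝ} (hr : 1 ≤ r) {μ : E3 → ℂ} (hμ : ContinuousOn μ {x : E3 | r ≤ ‖x‖}) :
    ContinuousOn (fun x => ‖μ x‖ ^ 2 / ‖x‖ ^ 2) {x : E3 | r ≤ ‖x‖} := by
  refine ContinuousOn.div (by fun_prop) (by fun_prop) ?_
  intro x hx
  have : r ≤ ‖x‖ := hx
  have : 0 < ‖x‖ := by linarith
  positivity

lemma shell_le {C : ℝ≥0∞} (hC1 : C ≠ ∞)
    (hC : (volume : Measure E3).toSphere ≤ C • (μH[2] : Measure (sphere (0 : E3) 1)))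
    {r : ℝ} (hr : 1 ≤ r) {μ : E3 → ℂ} (hμ : ContinuousOn μ {x : E3 | r ≤ ‖x‖})
    {a b : ℝ} (hra : r ≤ a) (hab : a ≤ b) :
    ∫ x in {x : E3 | a < ‖x‖ ∧ ‖x‖ < b}, ‖μ x‖ ^ 2 / ‖x‖ ^ 2 ≤
      C.toReal * ∫ t in a..b, sphAvg μ t := by
  set S := {x : E3 | a < ‖x‖ ∧ ‖x‖ < b} with hS
  have hSm : MeasurableSet S := shell_meas a b
  have hSr : S ⊆ {x : E3 | r ≤ ‖x‖} := fun x hx => hra.trans hx.1.le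
  have hG := G_cont hr hμ
  have hmc : ContinuousOn (sphAvg μ) (Icc a b) :=
    (sphAvg_continuousOn hr hμ).mono fun t ht => hra.trans ht.1
  have hmi : IntegrableOn (sphAvg μ) (Ioc a b) := hmc.integrableOn_Icc.mono_set Ioc_subset_Icc_self
  classical
  set f : E3 → ℝ≥0∞ := S.piecewise (fun x => ENNReal.ofReal (‖μ x‖ ^ 2 / ‖x‖ ^ 2)) (fun _ => 0) with hf
  have hfm : Measurable f := by
    apply ContinuousOn.measurable_piecewise _ continuousOn_const hSm
    exact ENNReal.continuous_ofReal.comp_continuousOn (hG.mono hSr)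
  have h1 := polar_lintegral_le hC f hfm
  have e1 : ∫⁻ x, f x = ENNReal.ofReal (∫ x in S, ‖μ x‖ ^ 2 / ‖x‖ ^ 2) := by
    rw [ofReal_integral_eq_lintegral_ofReal (shell_integrableOn a b hra hG)
      (ae_of_all _ fun x => by positivity), ← lintegral_indicator hSm, hf, ← Set.piecewise_eq_indicator]
    rfl
  have e2 : ∫⁻ t in Ioi (0 : ℝ), ENNReal.ofReal (t ^ 2) *
      ∫⁻ ω : sphere (0 : E3) 1, f (t • (ω : E3)) ∂μH[2] ≤ ENNReal.ofReal (∫ t in a..b, sphAvg μ t) := by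
    rw [intervalIntegral.integral_of_le hab, ofReal_integral_eq_lintegral_ofReal hmi
      (ae_of_all _ fun x => sphAvg_nonneg μ x), ← lintegral_indicator measurableSet_Ioi,
      ← lintegral_indicator measurableSet_Ioc]
    apply lintegral_mono
    intro t
    by_cases ht : a < t ∧ t < b
    · have ht0 : 0 < t := by linarith
      have hrt : r ≤ t := by linarith
      rw [indicator_of_mem (by exact ht0), indicator_of_mem (by exact ⟨ht.1, ht.2.le⟩), sphAvg_eq μ t ht0,
        ofReal_integral_eq_lintegral_ofReal _ (ae_of_all _ fun x => by positivity)]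
      · rw [← lintegral_const_mul' _ _ ENNReal.ofReal_ne_top]
        apply lintegral_mono
        intro w
        have hw : ‖t • (w : E3)‖ = t := by simp [norm_smul, abs_of_pos ht0]
        have hmem : t • (w : E3) ∈ S := by rw [hS, mem_ofPred_eq, hw]; exact ht
        simp only [hf, Set.piecewise_eq_of_mem _ _ _ hmem, hw]
        rw [← ENNReal.ofReal_mul (by positivity)]
        apply ENNReal.ofReal_le_ofReal
        rw [mul_div_cancel₀ _ (by positivity)]
      · have hc := (cont_sph hr hμ).comp (Continuous.prodMk_right t)
        have : Continuous (fun ω : sphere (0 : E3) 1 => ‖μ (t • (ω : E3))‖ ^ 2) := by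
          simpa [Function.comp_def, max_eq_right hrt] using hc
        exact this.integrable_of_hasCompactSupport (HasCompactSupport.of_compactSpace _)
    · refine le_trans (le_of_eq ?_) (zero_le)
      rw [indicator_apply]
      split_ifs with h0
      · have : ∀ w : sphere (0 : E3) 1, f (t • (w : E3)) = 0 := by
          intro w
          have hw : ‖t • (w : E3)‖ = t := by simp [norm_smul, abs_of_pos h0.out]
          have hmem : t • (w : E3) ∉ S := by rw [hS, mem_ofPred_eq, hw]; exact ht
          simp only [hf, Set.piecewise_eq_of_notMem _ _ _ hmem]
        simp [this]
      · rfl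
  have h0 : 0 ≤ ∫ t in a..b, sphAvg μ t := intervalIntegral.integral_nonneg hab fun t _ => sphAvg_nonneg μ t
  rw [e1] at h1
  have h2 := h1.trans (mul_le_mul_right e2 C)
  rw [← ENNReal.ofReal_toReal hC1, ← ENNReal.ofReal_mul ENNReal.toReal_nonneg,
    ENNReal.ofReal_le_ofReal_iff (by positivity)] at h2
  exact h2


lemma Msup_bound {r : ℝ} (hr : 1 ≤ r) {μ : E3 → ℂ} (hμ : ContinuousOn μ {x : E3 | r ≤ ‖x‖})
    (hb : BddAbove (Mset μ r)) {ρ : ℝ} (hρ : r ≤ ρ) :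
    ∫ t in ρ..(ρ + 1), sphAvg μ t ≤ Msup μ r := by
  rcases hρ.eq_or_lt with rfl | h
  · have hc : Continuous (fun t => sphAvg μ (max r t)) :=
      (sphAvg_continuousOn hr hμ).comp_continuous (by fun_prop) fun t => mem_Ici.2 (le_max_left _ _)
    have hi : ∀ a b, IntervalIntegrable (fun t => sphAvg μ (max r t)) volume a b :=
      fun a b => hc.intervalIntegrable a b
    have heq : ∀ ρ, r ≤ ρ → ∫ t in ρ..(ρ + 1), sphAvg μ t =
        (∫ t in r..(ρ + 1), sphAvg μ (max r t)) - ∫ t in r..ρ, sphAvg μ (max r t) := by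
      intro ρ hρ
      rw [intervalIntegral.integral_interval_sub_left (hi _ _) (hi _ _)]
      apply intervalIntegral.integral_congr
      intro t ht
      rw [uIcc_of_le (by linarith)] at ht
      simp only [max_eq_right (hρ.trans ht.1)]
    have hcont : Continuous (fun ρ => (∫ t in r..(ρ + 1), sphAvg μ (max r t)) -
        ∫ t in r..ρ, sphAvg μ (max r t)) := by
      have := intervalIntegral.continuous_primitive (fun a b => hi a b) r
      exact (this.comp (continuous_add_const 1)).sub this
    rw [heq r le_rfl]
    refine le_of_tendsto ((hcont.tendsto r).mono_left (nhdsWithin_le_nhds (s := Ioi r))) ?_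
    filter_upwards [self_mem_nhdsWithin] with ρ hρ
    rw [← heq ρ (le_of_lt hρ)]
    exact le_csSup hb ⟨ρ, hρ, rfl⟩
  · exact le_csSup hb ⟨ρ, h, rfl⟩

lemma Msup_nonneg {r : ℝ} (hr : 1 ≤ r) {μ : E3 → ℂ} (hμ : ContinuousOn μ {x : E3 | r ≤ ‖x‖})
    (hb : BddAbove (Mset μ r)) : 0 ≤ Msup μ r :=
  (intervalIntegral.integral_nonneg (by linarith) fun t _ => sphAvg_nonneg μ t).trans
    (Msup_bound hr hμ hb le_rfl)

lemma annulus_le {C : ℝ≥0∞} (hC1 : C ≠ ∞)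
    (hC : (volume : Measure E3).toSphere ≤ C • (μH[2] : Measure (sphere (0 : E3) 1)))
    {r : ℝ} (hr : 1 ≤ r) {μ : E3 → ℂ} (hμ : ContinuousOn μ {x : E3 | r ≤ ‖x‖})
    (hb : BddAbove (Mset μ r)) (R : ℝ) (n : ℕ) :
    ∫ x in {x : E3 | r < ‖x‖ ∧ ‖x‖ < R} ∩ {x : E3 | ⌊‖x‖⌋₊ = n}, ‖μ x‖ ^ 2 / ‖x‖ ^ 2 ≤
      C.toReal * Msup μ r := by
  have h1 := shell_le hC1 hC hr hμ (le_max_left r (n : ℝ)) (by linarith : max r (n : ℝ) ≤ max r (n : ℝ) + 1)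
  have h2 := Msup_bound hr hμ hb (le_max_left r (n : ℝ))
  refine le_trans ?_ (h1.trans (mul_le_mul_of_nonneg_left h2 ENNReal.toReal_nonneg))
  refine setIntegral_mono_set (shell_integrableOn _ _ (le_max_left _ _) (G_cont hr hμ))
    (ae_of_all _ fun x => by positivity) ?_
  have hnull : volume (sphere (0 : E3) n) = 0 := Measure.addHaar_sphere _ _ _
  filter_upwards [compl_mem_ae_iff.2 hnull] with x hx
  rintro ⟨⟨hx1, hx2⟩, hx3⟩
  have hx3' : ⌊‖x‖⌋₊ = n := hx3
  rw [Nat.floor_eq_iff (norm_nonneg _)] at hx3'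
  have hne : (n : ℝ) ≠ ‖x‖ := by
    intro h; apply hx; simp [h]
  refine ⟨max_lt hx1 (lt_of_le_of_ne hx3'.1 hne), ?_⟩
  have := le_max_right r (n : ℝ)
  linarith [hx3'.2]

lemma weighted_le {C : ℝ≥0∞} (hC1 : C ≠ ∞)
    (hC : (volume : Measure E3).toSphere ≤ C • (μH[2] : Measure (sphere (0 : E3) 1)))
    {r : ℝ} (hr : 1 ≤ r) {μ : E3 → ℂ} (hμ : ContinuousOn μ {x : E3 | r ≤ ‖x‖})
    (hb : BddAbove (Mset μ r)) (R : ℝ) (w : ℕ → ℝ) (hw : ∀ n, 0 ≤ w n) (T : ℝ)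
    (hT : ∀ N, ∑ n ∈ Finset.Ico ⌊r⌋₊ N, w n ≤ T)
    (f : E3 → ℝ) (hf : ContinuousOn f {x : E3 | r ≤ ‖x‖})
    (hfw : ∀ x : E3, r < ‖x‖ → f x ≤ w ⌊‖x‖⌋₊ * (‖μ x‖ ^ 2 / ‖x‖ ^ 2)) :
    ∫ x in {x : E3 | r < ‖x‖ ∧ ‖x‖ < R}, f x ≤ T * (C.toReal * Msup μ r) := by
  set S := {x : E3 | r < ‖x‖ ∧ ‖x‖ < R} with hS
  have hSm : MeasurableSet S := shell_meas r R
  have hAm : ∀ n : ℕ, MeasurableSet {x : E3 | ⌊‖x‖⌋₊ = n} := fun n =>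
    (Nat.measurable_floor.comp measurable_norm) (measurableSet_singleton n)
  have hGi : IntegrableOn (fun x : E3 => ‖μ x‖ ^ 2 / ‖x‖ ^ 2) S :=
    shell_integrableOn r R le_rfl (G_cont hr hμ)
  have hind : ∀ n : ℕ, IntegrableOn (fun x => w n * ({x : E3 | ⌊‖x‖⌋₊ = n}.indicator
      (fun x => ‖μ x‖ ^ 2 / ‖x‖ ^ 2) x)) S := fun n =>
    Integrable.const_mul (hGi.indicator (hAm n)) _
  calc ∫ x in S, f x ≤ ∫ x in S, ∑ n ∈ Finset.Ico ⌊r⌋₊ (⌊R⌋₊ + 1), w n *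
        ({x : E3 | ⌊‖x‖⌋₊ = n}.indicator (fun x => ‖μ x‖ ^ 2 / ‖x‖ ^ 2) x) := by
        refine setIntegral_mono_on (shell_integrableOn r R le_rfl hf)
          (integrable_finsetSum _ fun n _ => hind n) hSm ?_
        intro x hx
        refine (hfw x hx.1).trans ?_
        rw [Finset.sum_eq_single_of_mem ⌊‖x‖⌋₊]
        · rw [indicator_of_mem (by simp)]
        · rw [Finset.mem_Ico]
          exact ⟨Nat.floor_le_floor hx.1.le, Nat.lt_succ_of_le (Nat.floor_le_floor hx.2.le)⟩
        · intro n _ hn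
          rw [indicator_of_notMem (by simpa using hn.symm), mul_zero]
    _ = ∑ n ∈ Finset.Ico ⌊r⌋₊ (⌊R⌋₊ + 1), w n *
        ∫ x in S ∩ {x : E3 | ⌊‖x‖⌋₊ = n}, ‖μ x‖ ^ 2 / ‖x‖ ^ 2 := by
        rw [integral_finsetSum _ fun n _ => hind n]
        refine Finset.sum_congr rfl fun n _ => ?_
        rw [integral_const_mul, setIntegral_indicator (hAm n)]
    _ ≤ ∑ n ∈ Finset.Ico ⌊r⌋₊ (⌊R⌋₊ + 1), w n * (C.toReal * Msup μ r) := by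
        refine Finset.sum_le_sum fun n _ => mul_le_mul_of_nonneg_left ?_ (hw n)
        exact annulus_le hC1 hC hr hμ hb R n
    _ ≤ _ := by
        rw [← Finset.sum_mul]
        exact mul_le_mul_of_nonneg_right (hT _)
          (mul_nonneg ENNReal.toReal_nonneg (Msup_nonneg hr hμ hb))

lemma annSupV_nonneg (Q : E3 → E3) (n : ℕ) : 0 ≤ annSupV Q n := by
  unfold annSupV
  apply Real.sSup_nonneg
  rintro _ ⟨x, _, rfl⟩
  exact norm_nonneg _

lemma Q_le {Q : E3 → E3} (hQ : Continuous Q) (x : E3) (hx : 0 < ‖x‖) :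
    ‖Q x‖ ≤ annSupV Q ⌊‖x‖⌋₊ := by
  set n := ⌊‖x‖⌋₊ with hn
  have hbdd : BddAbove ((fun x => ‖Q x‖) '' {x : E3 | (n : ℝ) < ‖x‖ ∧ ‖x‖ < (n : ℝ) + 1}) := by
    refine ((isCompact_closedBall (0 : E3) (n + 1)).image hQ.norm).bddAbove.mono ?_
    apply image_mono
    intro y hy
    simpa using hy.2.le
  have h1 : (n : ℝ) ≤ ‖x‖ := Nat.floor_le (norm_nonneg _)
  have h2 : ‖x‖ < n + 1 := Nat.lt_floor_add_one _
  have hc : Continuous (fun s : ℝ => ‖Q (s • x)‖) := by fun_prop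
  have ht := (hc.tendsto 1).mono_left (nhdsWithin_le_nhds (s := Ioi 1))
  simp only [one_smul] at ht
  refine le_of_tendsto ht ?_
  have h3 : 1 < (n + 1) / ‖x‖ := by rw [lt_div_iff₀ hx]; linarith
  filter_upwards [Ioo_mem_nhdsGT h3] with s hs
  apply le_csSup hbdd
  refine ⟨s • x, ?_, rfl⟩
  have hs0 : 0 < s := by linarith [hs.1]
  have h4 : ‖s • x‖ = s * ‖x‖ := by rw [norm_smul, Real.norm_of_nonneg hs0.le]
  rw [mem_ofPred_eq, h4]
  have := hs.2
  rw [lt_div_iff₀ hx] at this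
  exact ⟨by nlinarith [hs.1], this⟩

lemma tail_sum {Q : E3 → E3} (hs : Summable (fun n => (annSupV Q n) ^ 2)) (r : ℝ) (N : ℕ) :
    ∑ n ∈ Finset.Ico ⌊r⌋₊ N, annSupV Q n ^ 2 ≤ l2LinfTail Q r ^ 2 := by
  have hs' : Summable (fun n => (annSupV Q (⌊r⌋₊ + n)) ^ 2) := by
    simpa [add_comm] using (summable_nat_add_iff (f := fun n => (annSupV Q n) ^ 2) ⌊r⌋₊).2 hs
  unfold l2LinfTail
  rw [Real.sq_sqrt (tsum_nonneg fun _ => sq_nonneg _), Finset.sum_Ico_eq_sum_range]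
  exact hs'.sum_le_tsum _ fun _ _ => sq_nonneg _

lemma l2_nonneg (Q : E3 → E3) (r : ℝ) : 0 ≤ l2LinfTail Q r := Real.sqrt_nonneg _

lemma Q_le_tail {Q : E3 → E3} (hQ : Continuous Q) (hs : Summable (fun n => (annSupV Q n) ^ 2))
    {r : ℝ} (hr : 1 ≤ r) (x : E3) (hx : r ≤ ‖x‖) : ‖Q x‖ ≤ l2LinfTail Q r := by
  refine (Q_le hQ x (by linarith)).trans ?_
  have h1 := tail_sum hs r (⌊‖x‖⌋₊ + 1)
  have h2 : annSupV Q ⌊‖x‖⌋₊ ^ 2 ≤ ∑ n ∈ Finset.Ico ⌊r⌋₊ (⌊‖x‖⌋₊ + 1), annSupV Q n ^ 2 :=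
    Finset.single_le_sum (f := fun n => annSupV Q n ^ 2) (fun _ _ => sq_nonneg _)
      (Finset.mem_Ico.2 ⟨Nat.floor_le_floor hx, Nat.lt_succ_self _⟩)
  exact le_of_sq_le_sq (h2.trans h1) (l2_nonneg _ _)

lemma invsq_sum {r : ℝ} (hr : 1 ≤ r) (N : ℕ) :
    ∑ n ∈ Finset.Ico ⌊r⌋₊ N, ((n : ℝ) ^ 2)⁻¹ ≤ 6 / (r + 1) := by
  have h1 : 1 ≤ ⌊r⌋₊ := by simpa using hr
  obtain ⟨k, hk⟩ : ∃ k, ⌊r⌋₊ = k + 1 := ⟨⌊r⌋₊ - 1, by omega⟩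
  have h2 := Nat.lt_floor_add_one r
  rw [hk] at h2 ⊢
  have h3 := sum_Ioo_inv_sq_le (α := ℝ) k N
  have h4 : Finset.Ico (k + 1) N = Finset.Ioo k N := by
    ext; simp [Finset.mem_Ico, Finset.mem_Ioo]
  rw [h4]
  refine h3.trans ?_
  push_cast at h2
  rw [div_le_div_iff₀ (by positivity) (by linarith)]
  have : (0 : ℝ) ≤ k := by positivity
  linarith

lemma cs_le {ν : Measure E3} {f g : E3 → ℝ} (hf0 : ∀ x, 0 ≤ f x) (hg0 : ∀ x, 0 ≤ g x)
    (hfm : AEStronglyMeasurable f ν) (hgm : AEStronglyMeasurable g ν)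
    (hf : Integrable (fun x => f x ^ 2) ν) (hg : Integrable (fun x => g x ^ 2) ν) :
    Integrable (fun x => f x * g x) ν ∧
    ∫ x, f x * g x ∂ν ≤ Real.sqrt (∫ x, f x ^ 2 ∂ν) * Real.sqrt (∫ x, g x ^ 2 ∂ν) := by
  have hf2 := (memLp_two_iff_integrable_sq hfm).2 hf
  have hg2 := (memLp_two_iff_integrable_sq hgm).2 hg
  refine ⟨hf2.integrable_mul hg2, ?_⟩
  have h := integral_mul_le_Lp_mul_Lq_of_nonneg (μ := ν) Real.HolderConjugate.two_two
    (ae_of_all _ hf0) (ae_of_all _ hg0) (by simpa using hf2) (by simpa using hg2)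
  simpa [Real.sqrt_eq_rpow] using h


lemma eta_deriv_bound : ∃ K : ℝ, 0 < K ∧ ∀ t, |deriv Real.smoothTransition t| ≤ K := by
  have hcd : ContDiff ℝ 1 Real.smoothTransition := Real.smoothTransition.contDiff
  have hc : Continuous (deriv Real.smoothTransition) := hcd.continuous_deriv le_rfl
  obtain ⟨K, hK⟩ := (isCompact_Icc (a := (0 : ℝ)) (b := 1)).exists_bound_of_continuousOn hc.continuousOn
  refine ⟨max K 1, by positivity, fun t => ?_⟩
  by_cases ht : t ∈ Icc (0 : ℝ) 1
  · exact (hK t ht).trans (le_max_left _ _)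
  · have : deriv Real.smoothTransition t = 0 := by
      rw [mem_Icc, not_and_or, not_le, not_le] at ht
      rcases ht with ht | ht
      · have : Real.smoothTransition =ᶠ[𝓝 t] fun _ => 0 := by
          filter_upwards [Iio_mem_nhds ht] with s hs
          exact Real.smoothTransition.zero_of_nonpos (le_of_lt hs)
        rw [this.deriv_eq]; simp
      · have : Real.smoothTransition =ᶠ[𝓝 t] fun _ => 1 := by
          filter_upwards [Ioi_mem_nhds ht] with s hs
          exact Real.smoothTransition.one_of_one_le (le_of_lt hs)
        rw [this.deriv_eq]; simp
    rw [this]; simp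

/-- radial cutoff -/
noncomputable def hcut (r R ε t : ℝ) : ℝ :=
  Real.smoothTransition ((t - r) / ε - 1) * Real.smoothTransition ((R - t) / ε - 1)

lemma hcut_nonneg (r R ε t : ℝ) : 0 ≤ hcut r R ε t :=
  mul_nonneg (Real.smoothTransition.nonneg _) (Real.smoothTransition.nonneg _)

lemma hcut_le_one (r R ε t : ℝ) : hcut r R ε t ≤ 1 :=
  mul_le_one₀ (Real.smoothTransition.le_one _) (Real.smoothTransition.nonneg _)
    (Real.smoothTransition.le_one _)

lemma hcut_contDiff (r R ε : ℝ) : ContDiff ℝ 1 (hcut r R ε) := by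
  unfold hcut
  have hcd : ContDiff ℝ 1 Real.smoothTransition := Real.smoothTransition.contDiff
  fun_prop

lemma hcut_zero_left {r R ε t : ℝ} (hε : 0 < ε) (ht : t ≤ r + ε) : hcut r R ε t = 0 := by
  unfold hcut
  rw [Real.smoothTransition.zero_of_nonpos, zero_mul]
  rw [sub_nonpos, div_le_one hε]; linarith

lemma hcut_zero_right {r R ε t : ℝ} (hε : 0 < ε) (ht : R - ε ≤ t) : hcut r R ε t = 0 := by
  unfold hcut
  rw [mul_comm, Real.smoothTransition.zero_of_nonpos, zero_mul]
  rw [sub_nonpos, div_le_one hε]; linarith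

lemma hcut_one {r R ε t : ℝ} (hε : 0 < ε) (h1 : r + 2 * ε ≤ t) (h2 : t ≤ R - 2 * ε) :
    hcut r R ε t = 1 := by
  unfold hcut
  rw [Real.smoothTransition.one_of_one_le, Real.smoothTransition.one_of_one_le, one_mul]
  · rw [le_sub_iff_add_le, le_div_iff₀ hε]; linarith
  · rw [le_sub_iff_add_le, le_div_iff₀ hε]; linarith

lemma hcut_deriv_le {K : ℝ} (hK : ∀ t, |deriv Real.smoothTransition t| ≤ K) {r R ε : ℝ} (hε : 0 < ε)
    (t : ℝ) : |deriv (hcut r R ε) t| ≤ 2 * K / ε := by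
  have hd : Differentiable ℝ Real.smoothTransition :=
    (Real.smoothTransition.contDiff (n := 1)).differentiable one_ne_zero
  have h1 : HasDerivAt (fun t => Real.smoothTransition ((t - r) / ε - 1))
      (deriv Real.smoothTransition ((t - r) / ε - 1) * (1 / ε)) t :=
    (hd _).hasDerivAt.comp t ((((hasDerivAt_id t).sub_const r).div_const ε).sub_const 1)
  have h2 : HasDerivAt (fun t => Real.smoothTransition ((R - t) / ε - 1))
      (deriv Real.smoothTransition ((R - t) / ε - 1) * (-1 / ε)) t :=
    (hd _).hasDerivAt.comp t ((((hasDerivAt_id t).const_sub R).div_const ε).sub_const 1)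
  have h3 : HasDerivAt (hcut r R ε) _ t := h1.mul h2
  rw [h3.deriv]
  refine (abs_add_le _ _).trans ?_
  rw [abs_mul, abs_mul, abs_mul, abs_mul, abs_div, abs_div, abs_neg, abs_one, abs_of_pos hε,
    abs_of_nonneg (Real.smoothTransition.nonneg _), abs_of_nonneg (Real.smoothTransition.nonneg _)]
  have hK0 : 0 ≤ K := (abs_nonneg _).trans (hK 0)
  have e : ∀ a b : ℝ, a ≤ K → 0 ≤ a → 0 ≤ b → b ≤ 1 → a * (1 / ε) * b ≤ K / ε := by
    intro a b h1 h2 h3 h4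
    calc a * (1 / ε) * b ≤ K * (1 / ε) * 1 := by gcongr
      _ = K / ε := by ring
  have ha := e _ _ (hK ((t - r) / ε - 1)) (abs_nonneg _)
    (Real.smoothTransition.nonneg ((R - t) / ε - 1)) (Real.smoothTransition.le_one _)
  have hb := e _ _ (hK ((R - t) / ε - 1)) (abs_nonneg _)
    (Real.smoothTransition.nonneg ((t - r) / ε - 1)) (Real.smoothTransition.le_one _)
  calc _ ≤ K / ε + K / ε := by
        refine add_le_add ha ?_
        rw [mul_comm]; exact hb
    _ = _ := by ring

lemma hcut_deriv_zero {r R ε t : ℝ} (hε : 0 < ε) (h1 : r + 3 * ε ≤ t) (h2 : t ≤ R - 3 * ε) :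
    deriv (hcut r R ε) t = 0 := by
  have : hcut r R ε =ᶠ[𝓝 t] fun _ => 1 := by
    filter_upwards [Ioo_mem_nhds (show r + 2 * ε < t by linarith) (show t < R - 2 * ε by linarith)] with s hs
    exact hcut_one hε hs.1.le hs.2.le
  rw [this.deriv_eq]; simp

/-- Derivative bound for `‖μ‖²/‖x‖²`. -/
lemma G_fderiv {μ : E3 → ℂ} {x : E3} (hx : 0 < ‖x‖) (hd : DifferentiableAt ℝ μ x) :
    DifferentiableAt ℝ (fun x => ‖μ x‖ ^ 2 / ‖x‖ ^ 2) x ∧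
    ∀ v, |fderiv ℝ (fun x => ‖μ x‖ ^ 2 / ‖x‖ ^ 2) x v| ≤
      2 * (‖μ x‖ * ‖fderiv ℝ μ x‖ / ‖x‖ ^ 2) * ‖v‖ + 2 * (‖μ x‖ ^ 2 / ‖x‖ ^ 3) * ‖v‖ := by
  have h1 : HasFDerivAt (fun x => ‖μ x‖ ^ 2) _ x := hd.hasFDerivAt.norm_sq
  have h2 : HasFDerivAt (fun x : E3 => ‖x‖ ^ 2) _ x := (hasStrictFDerivAt_norm_sq x).hasFDerivAt
  have hx2 : ‖x‖ ^ 2 ≠ 0 := by positivity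
  have h3 := h1.mul ((hasDerivAt_inv hx2).comp_hasFDerivAt x h2)
  have heq : (fun x => ‖μ x‖ ^ 2 / ‖x‖ ^ 2) = (fun x => ‖μ x‖ ^ 2) * ((fun y => y⁻¹) ∘ fun x : E3 => ‖x‖ ^ 2) := by
    ext y; simp [div_eq_mul_inv]
  rw [heq]
  refine ⟨h3.differentiableAt, fun v => ?_⟩
  rw [h3.fderiv]
  have b1 : |inner ℝ (μ x) (fderiv ℝ μ x v)| ≤ ‖μ x‖ * (‖fderiv ℝ μ x‖ * ‖v‖) :=
    (abs_real_inner_le_norm _ _).trans (by gcongr; exact ContinuousLinearMap.le_opNorm _ _)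
  have b2 : |inner ℝ x v| ≤ ‖x‖ * ‖v‖ := abs_real_inner_le_norm _ _
  have e : (‖μ x‖ ^ 2 * (-((‖x‖ ^ 2) ^ 2)⁻¹ * (2 * inner ℝ x v)) +
      (‖x‖ ^ 2)⁻¹ * (2 * inner ℝ (μ x) (fderiv ℝ μ x v))) =
      2 * (inner ℝ (μ x) (fderiv ℝ μ x v) / ‖x‖ ^ 2) - 2 * (‖μ x‖ ^ 2 * inner ℝ x v / ‖x‖ ^ 4) := by
    field_simp
    ring
  have e2 : |2 * (inner ℝ (μ x) (fderiv ℝ μ x v) / ‖x‖ ^ 2) - 2 * (‖μ x‖ ^ 2 * inner ℝ x v / ‖x‖ ^ 4)| ≤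
      2 * (‖μ x‖ * ‖fderiv ℝ μ x‖ / ‖x‖ ^ 2) * ‖v‖ + 2 * (‖μ x‖ ^ 2 / ‖x‖ ^ 3) * ‖v‖ := by
    refine (abs_sub _ _).trans ?_
    rw [abs_mul, abs_mul, abs_div, abs_div, abs_mul, abs_of_pos (show (0 : ℝ) < 2 by norm_num),
      abs_of_pos (show 0 < ‖x‖ ^ 2 by positivity), abs_of_pos (show 0 < ‖x‖ ^ 4 by positivity),
      abs_of_nonneg (show 0 ≤ ‖μ x‖ ^ 2 by positivity)]
    have c1 : |inner ℝ (μ x) (fderiv ℝ μ x v)| / ‖x‖ ^ 2 ≤ (‖μ x‖ * (‖fderiv ℝ μ x‖ * ‖v‖)) / ‖x‖ ^ 2 := by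
      gcongr
    have c2 : ‖μ x‖ ^ 2 * |inner ℝ x v| / ‖x‖ ^ 4 ≤ ‖μ x‖ ^ 2 * (‖x‖ * ‖v‖) / ‖x‖ ^ 4 := by
      gcongr
    have c3 : ‖μ x‖ ^ 2 * (‖x‖ * ‖v‖) / ‖x‖ ^ 4 = (‖μ x‖ ^ 2 / ‖x‖ ^ 3) * ‖v‖ := by
      field_simp
    have c4 : (‖μ x‖ * (‖fderiv ℝ μ x‖ * ‖v‖)) / ‖x‖ ^ 2 = (‖μ x‖ * ‖fderiv ℝ μ x‖ / ‖x‖ ^ 2) * ‖v‖ := by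
      ring
    rw [c3] at c2
    rw [c4] at c1
    linarith
  rw [← e] at e2
  convert e2 using 2
  simp [-Complex.inner, innerSL_apply_apply]

/-- Derivative bound for the cutoff. -/
lemma cut_fderiv (r R ε : ℝ) {x : E3} (hx : 0 < ‖x‖) :
    DifferentiableAt ℝ (fun x : E3 => hcut r R ε ‖x‖) x ∧
    ∀ v, |fderiv ℝ (fun x : E3 => hcut r R ε ‖x‖) x v| ≤ |deriv (hcut r R ε) ‖x‖| * ‖v‖ := by
  have hn : DifferentiableAt ℝ (fun x : E3 => ‖x‖) x :=
    (contDiffAt_norm (n := 1) ℝ (norm_pos_iff.1 hx)).differentiableAt one_ne_zero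
  have hh : DifferentiableAt ℝ (hcut r R ε) ‖x‖ :=
    ((hcut_contDiff r R ε).differentiable one_ne_zero) _
  have h : HasFDerivAt (fun x : E3 => hcut r R ε ‖x‖) _ x :=
    hh.hasDerivAt.comp_hasFDerivAt x hn.hasFDerivAt
  refine ⟨h.differentiableAt, fun v => ?_⟩
  rw [h.fderiv]
  have h1 : ‖fderiv ℝ (fun x : E3 => ‖x‖) x‖ ≤ 1 := by
    have := norm_fderiv_le_of_lipschitz ℝ (f := fun x : E3 => ‖x‖) (x₀ := x) lipschitzWith_one_norm
    simpa using this
  have h2 : |fderiv ℝ (fun x : E3 => ‖x‖) x v| ≤ ‖v‖ := by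
    refine ((fderiv ℝ (fun x : E3 => ‖x‖) x).le_opNorm v).trans ?_
    exact mul_le_of_le_one_left (norm_nonneg _) h1
  simp only [smul_apply, smul_eq_mul, abs_mul]
  gcongr

/-- Integration by parts against a compactly supported scalar function. -/
lemma ibp {Q : E3 → E3} (hQ : ContDiff ℝ 1 Q) {φ : E3 → ℝ} (hφ : ContDiff ℝ 1 φ)
    (hs : HasCompactSupport φ) :
    ∫ x, rdiv Q x * φ x = - ∫ x, fderiv ℝ φ x (Q x) := by
  have hQi : ∀ i : Fin 3, ContDiff ℝ 1 (fun y => Q y i) := fun i => (contDiff_euclidean.1 hQ) i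
  have hφ' : Continuous (fderiv ℝ φ) := hφ.continuous_fderiv one_ne_zero
  have hQ' : ∀ i : Fin 3, Continuous (fderiv ℝ (fun y => Q y i)) := fun i =>
    (hQi i).continuous_fderiv one_ne_zero
  have i1 : ∀ i : Fin 3, Integrable (fun x => fderiv ℝ (fun y => Q y i) x (EuclideanSpace.single i 1) * φ x) := by
    intro i
    refine Continuous.integrable_of_hasCompactSupport ?_ hs.mul_left
    exact ((hQ' i).clm_apply continuous_const).mul hφ.continuous
  have i2 : ∀ i : Fin 3, Integrable (fun x => Q x i * fderiv ℝ φ x (EuclideanSpace.single i 1)) := by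
    intro i
    refine Continuous.integrable_of_hasCompactSupport ?_ (HasCompactSupport.mul_left (hs.fderiv_apply ℝ _))
    exact (hQi i).continuous.mul (hφ'.clm_apply continuous_const)
  have i3 : ∀ i : Fin 3, Integrable (fun x => Q x i * φ x) := by
    intro i
    refine Continuous.integrable_of_hasCompactSupport ?_ hs.mul_left
    exact (hQi i).continuous.mul hφ.continuous
  have e1 : ∀ x, rdiv Q x * φ x = ∑ i : Fin 3, fderiv ℝ (fun y => Q y i) x (EuclideanSpace.single i 1) * φ x := by
    intro x; rw [rdiv, Finset.sum_mul]
  have e2 : ∀ x, fderiv ℝ φ x (Q x) = ∑ i : Fin 3, Q x i * fderiv ℝ φ x (EuclideanSpace.single i 1) := by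
    intro x
    have : Q x = ∑ i : Fin 3, Q x i • (EuclideanSpace.single i (1 : ℝ) : E3) := by
      ext j
      simp [Fin.sum_univ_three]
      fin_cases j <;> simp
    conv_lhs => rw [this]
    simp [map_sum]
  simp_rw [e1, e2]
  rw [integral_finsetSum _ fun i _ => i1 i, integral_finsetSum _ fun i _ => i2 i, ← Finset.sum_neg_distrib]
  refine Finset.sum_congr rfl fun i _ => ?_
  rw [integral_mul_fderiv_eq_neg_fderiv_mul_of_integrable (i1 i) (i2 i) (i3 i), neg_neg]
  · exact fun x _ => (hQi i).differentiable one_ne_zero x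
  · exact fun x _ => hφ.differentiable one_ne_zero x


/-- First interior term. -/
lemma interior1 {C : ℝ≥0∞} (hC1 : C ≠ ∞)
    (hC : (volume : Measure E3).toSphere ≤ C • (μH[2] : Measure (sphere (0 : E3) 1)))
    {Q : E3 → E3} (hQ : Continuous Q) (hs : Summable (fun n => (annSupV Q n) ^ 2))
    {r : ℝ} (hr : 1 ≤ r) {μ : E3 → ℂ} (hμ : ContDiffOn ℝ 1 μ {x : E3 | r ≤ ‖x‖})
    (hA : IntegrableOn (fun x : E3 => ‖fderiv ℝ μ x‖ ^ 2 / ‖x‖ ^ 2) {x : E3 | r < ‖x‖})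
    (hb : BddAbove (Mset μ r)) (R : ℝ) :
    IntegrableOn (fun x => (‖Q x‖ * ‖μ x‖ / ‖x‖) * (‖fderiv ℝ μ x‖ / ‖x‖)) {x : E3 | r < ‖x‖ ∧ ‖x‖ < R} ∧
    ∫ x in {x : E3 | r < ‖x‖ ∧ ‖x‖ < R}, (‖Q x‖ * ‖μ x‖ / ‖x‖) * (‖fderiv ℝ μ x‖ / ‖x‖) ≤
      l2LinfTail Q r * Real.sqrt C.toReal * Real.sqrt (Aint μ r * Msup μ r) := by
  set S := {x : E3 | r < ‖x‖ ∧ ‖x‖ < R} with hS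
  have hμc := hμ.continuousOn
  have hn0 : ∀ x : E3, x ∈ {x : E3 | r ≤ ‖x‖} → ‖x‖ ≠ 0 := fun x hx => by
    have : r ≤ ‖x‖ := hx
    linarith
  have hfc : ContinuousOn (fun x => ‖Q x‖ * ‖μ x‖ / ‖x‖) {x : E3 | r ≤ ‖x‖} :=
    ContinuousOn.div (by fun_prop) (by fun_prop) hn0
  have hSo : IsOpen S := (isOpen_lt continuous_const continuous_norm).inter
    (isOpen_lt continuous_norm continuous_const)
  have hSsub : S ⊆ {x : E3 | r ≤ ‖x‖} := fun x hx => hx.1.le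
  have hgc : ContinuousOn (fun x => ‖fderiv ℝ μ x‖ / ‖x‖) S :=
    ContinuousOn.div ((hμ.mono hSsub).continuousOn_fderiv_of_isOpen hSo le_rfl).norm
      (by fun_prop) fun x hx => hn0 x (hSsub hx)
  have hSA : S ⊆ {x : E3 | r < ‖x‖} := fun x hx => hx.1
  have hg2 : IntegrableOn (fun x => (‖fderiv ℝ μ x‖ / ‖x‖) ^ 2) S := by
    simpa only [div_pow] using hA.mono_set hSA
  have hf2 : IntegrableOn (fun x => (‖Q x‖ * ‖μ x‖ / ‖x‖) ^ 2) S :=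
    shell_integrableOn r R le_rfl (hfc.pow 2)
  have h := cs_le (ν := volume.restrict S) (f := fun x => ‖Q x‖ * ‖μ x‖ / ‖x‖)
    (g := fun x => ‖fderiv ℝ μ x‖ / ‖x‖) (fun x => by positivity) (fun x => by positivity)
    ((hfc.mono hSsub).aestronglyMeasurable hSo.measurableSet)
    (hgc.aestronglyMeasurable hSo.measurableSet) hf2 hg2
  refine ⟨h.1, h.2.trans ?_⟩
  have hM := Msup_nonneg hr hμc hb
  have hfle : ∫ x in S, (‖Q x‖ * ‖μ x‖ / ‖x‖) ^ 2 ≤ l2LinfTail Q r ^ 2 * (C.toReal * Msup μ r) := by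
    refine weighted_le hC1 hC hr hμc hb R (fun n => annSupV Q n ^ 2) (fun _ => sq_nonneg _) _
      (tail_sum hs r) _ (hfc.pow 2) ?_
    intro x hx
    have := Q_le hQ x (by linarith)
    calc (‖Q x‖ * ‖μ x‖ / ‖x‖) ^ 2 = ‖Q x‖ ^ 2 * (‖μ x‖ ^ 2 / ‖x‖ ^ 2) := by ring
      _ ≤ _ := by gcongr
  have hgle : ∫ x in S, (‖fderiv ℝ μ x‖ / ‖x‖) ^ 2 ≤ Aint μ r := by
    simp only [div_pow]
    exact setIntegral_mono_set hA (ae_of_all _ fun x => by positivity) hSA.eventuallyLE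
  have hA0 : 0 ≤ Aint μ r := integral_nonneg fun x => by positivity
  calc _ ≤ Real.sqrt (l2LinfTail Q r ^ 2 * (C.toReal * Msup μ r)) * Real.sqrt (Aint μ r) := by
        gcongr
    _ = _ := by
        rw [Real.sqrt_mul (sq_nonneg _), Real.sqrt_sq (l2_nonneg _ _),
          Real.sqrt_mul ENNReal.toReal_nonneg, Real.sqrt_mul hA0]
        ring

/-- Second interior term. -/
lemma interior2 {C : ℝ≥0∞} (hC1 : C ≠ ∞)
    (hC : (volume : Measure E3).toSphere ≤ C • (μH[2] : Measure (sphere (0 : E3) 1)))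
    {Q : E3 → E3} (hQ : Continuous Q) (hs : Summable (fun n => (annSupV Q n) ^ 2))
    {r : ℝ} (hr : 1 ≤ r) {μ : E3 → ℂ} (hμc : ContinuousOn μ {x : E3 | r ≤ ‖x‖})
    (hb : BddAbove (Mset μ r)) (R : ℝ) :
    IntegrableOn (fun x => (‖Q x‖ * ‖μ x‖ / ‖x‖) * (‖μ x‖ / ‖x‖ ^ 2)) {x : E3 | r < ‖x‖ ∧ ‖x‖ < R} ∧
    ∫ x in {x : E3 | r < ‖x‖ ∧ ‖x‖ < R}, (‖Q x‖ * ‖μ x‖ / ‖x‖) * (‖μ x‖ / ‖x‖ ^ 2) ≤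
      l2LinfTail Q r * C.toReal * Real.sqrt 6 * (Msup μ r * (Real.sqrt (r + 1))⁻¹) := by
  set S := {x : E3 | r < ‖x‖ ∧ ‖x‖ < R} with hS
  have hn0 : ∀ x : E3, x ∈ {x : E3 | r ≤ ‖x‖} → ‖x‖ ≠ 0 := fun x hx => by
    have : r ≤ ‖x‖ := hx
    linarith
  have hfc : ContinuousOn (fun x => ‖Q x‖ * ‖μ x‖ / ‖x‖) {x : E3 | r ≤ ‖x‖} :=
    ContinuousOn.div (by fun_prop) (by fun_prop) hn0
  have hgc : ContinuousOn (fun x => ‖μ x‖ / ‖x‖ ^ 2) {x : E3 | r ≤ ‖x‖} :=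
    ContinuousOn.div (by fun_prop) (by fun_prop) fun x hx => pow_ne_zero 2 (hn0 x hx)
  have hSm : MeasurableSet S := shell_meas r R
  have hSsub : S ⊆ {x : E3 | r ≤ ‖x‖} := fun x hx => hx.1.le
  have hg2 : IntegrableOn (fun x => (‖μ x‖ / ‖x‖ ^ 2) ^ 2) S :=
    shell_integrableOn r R le_rfl (hgc.pow 2)
  have hf2 : IntegrableOn (fun x => (‖Q x‖ * ‖μ x‖ / ‖x‖) ^ 2) S :=
    shell_integrableOn r R le_rfl (hfc.pow 2)
  have h := cs_le (ν := volume.restrict S) (f := fun x => ‖Q x‖ * ‖μ x‖ / ‖x‖)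
    (g := fun x => ‖μ x‖ / ‖x‖ ^ 2) (fun x => by positivity) (fun x => by positivity)
    ((hfc.mono hSsub).aestronglyMeasurable hSm)
    ((hgc.mono hSsub).aestronglyMeasurable hSm) hf2 hg2
  refine ⟨h.1, h.2.trans ?_⟩
  have hM := Msup_nonneg hr hμc hb
  have hfle : ∫ x in S, (‖Q x‖ * ‖μ x‖ / ‖x‖) ^ 2 ≤ l2LinfTail Q r ^ 2 * (C.toReal * Msup μ r) := by
    refine weighted_le hC1 hC hr hμc hb R (fun n => annSupV Q n ^ 2) (fun _ => sq_nonneg _) _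
      (tail_sum hs r) _ (hfc.pow 2) ?_
    intro x hx
    have := Q_le hQ x (by linarith)
    calc (‖Q x‖ * ‖μ x‖ / ‖x‖) ^ 2 = ‖Q x‖ ^ 2 * (‖μ x‖ ^ 2 / ‖x‖ ^ 2) := by ring
      _ ≤ _ := by gcongr
  have hgle : ∫ x in S, (‖μ x‖ / ‖x‖ ^ 2) ^ 2 ≤ 6 / (r + 1) * (C.toReal * Msup μ r) := by
    refine weighted_le hC1 hC hr hμc hb R (fun n => ((n : ℝ) ^ 2)⁻¹) (fun _ => by positivity) _
      (invsq_sum hr) _ (hgc.pow 2) ?_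
    intro x hx
    have h1 : (⌊‖x‖⌋₊ : ℝ) ≤ ‖x‖ := Nat.floor_le (norm_nonneg _)
    have h2 : (0 : ℝ) < ⌊‖x‖⌋₊ := by
      have : 0 < ⌊‖x‖⌋₊ := Nat.floor_pos.2 (by linarith)
      exact_mod_cast this
    calc (‖μ x‖ / ‖x‖ ^ 2) ^ 2 = (‖x‖ ^ 2)⁻¹ * (‖μ x‖ ^ 2 / ‖x‖ ^ 2) := by
          rw [div_pow, div_eq_mul_inv, div_eq_mul_inv, ← pow_mul, ← inv_pow, ← inv_pow]; ring
      _ ≤ _ := by gcongr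
  have hr1 : 0 ≤ r + 1 := by linarith
  calc _ ≤ Real.sqrt (l2LinfTail Q r ^ 2 * (C.toReal * Msup μ r)) *
        Real.sqrt (6 / (r + 1) * (C.toReal * Msup μ r)) := by
        gcongr
    _ = l2LinfTail Q r * (Real.sqrt (C.toReal * Msup μ r) * Real.sqrt (C.toReal * Msup μ r)) *
          (Real.sqrt 6 / Real.sqrt (r + 1)) := by
        rw [Real.sqrt_mul (sq_nonneg _), Real.sqrt_sq (l2_nonneg _ _),
          Real.sqrt_mul (by positivity : 0 ≤ 6 / (r + 1)), Real.sqrt_div (by norm_num)]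
        ring
    _ = _ := by
        rw [Real.mul_self_sqrt (by positivity)]
        ring

/-- Regularity of the localized weight. -/
lemma phi_reg {r : ℝ} (hr : 1 ≤ r) {μ : E3 → ℂ} (hμ : ContDiffOn ℝ 1 μ {x : E3 | r ≤ ‖x‖})
    {R ε : ℝ} (hε : 0 < ε) :
    ContDiff ℝ 1 (fun x : E3 => hcut r R ε ‖x‖ * (‖μ x‖ ^ 2 / ‖x‖ ^ 2)) ∧
    HasCompactSupport (fun x : E3 => hcut r R ε ‖x‖ * (‖μ x‖ ^ 2 / ‖x‖ ^ 2)) := by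
  constructor
  · rw [contDiff_iff_contDiffAt]
    intro x
    by_cases hx : r < ‖x‖
    · have hm : ContDiffAt ℝ 1 μ x := hμ.contDiffAt
        (mem_of_superset ((isOpen_lt continuous_const continuous_norm).mem_nhds hx) fun y (hy : r < ‖y‖) => (le_of_lt hy : r ≤ ‖y‖))
      have hx0 : x ≠ 0 := norm_pos_iff.1 (by linarith)
      have hn : ContDiffAt ℝ 1 (fun x : E3 => ‖x‖) x := contDiffAt_norm ℝ hx0
      have h1 : ContDiffAt ℝ 1 (fun x : E3 => hcut r R ε ‖x‖) x :=
        (hcut_contDiff r R ε).contDiffAt.comp x hn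
      have h2 : ContDiffAt ℝ 1 (fun x : E3 => ‖μ x‖ ^ 2) x := hm.norm_sq ℝ
      exact h1.mul (h2.div (hn.pow 2) (by have : 0 < ‖x‖ := norm_pos_iff.2 hx0; positivity))
    · have : (fun x : E3 => hcut r R ε ‖x‖ * (‖μ x‖ ^ 2 / ‖x‖ ^ 2)) =ᶠ[𝓝 x] fun _ => 0 := by
        have hx' : ‖x‖ < r + ε := by linarith [not_lt.1 hx]
        filter_upwards [(isOpen_lt continuous_norm continuous_const).mem_nhds hx'] with y hy
        rw [hcut_zero_left hε (le_of_lt hy), zero_mul]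
      exact contDiffAt_const.congr_of_eventuallyEq this
  · refine HasCompactSupport.intro (isCompact_closedBall (0 : E3) R) fun x hx => ?_
    have : R < ‖x‖ := by simpa using hx
    rw [hcut_zero_right hε (by linarith), zero_mul]


/-- The estimate at a fixed cutoff scale. -/
lemma fixed_eps {C : ℝ≥0∞} (hC1 : C ≠ ∞)
    (hC : (volume : Measure E3).toSphere ≤ C • (μH[2] : Measure (sphere (0 : E3) 1)))
    {K : ℝ} (hK0 : 0 < K) (hK : ∀ t, |deriv Real.smoothTransition t| ≤ K)
    {Q : E3 → E3} (hQ : ContDiff ℝ 1 Q) (hs : Summable (fun n => (annSupV Q n) ^ 2))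
    {r : ℝ} (hr : 1 ≤ r) {μ : E3 → ℂ} (hμ : ContDiffOn ℝ 1 μ {x : E3 | r ≤ ‖x‖})
    (hA : IntegrableOn (fun x : E3 => ‖fderiv ℝ μ x‖ ^ 2 / ‖x‖ ^ 2) {x : E3 | r < ‖x‖})
    (hb : BddAbove (Mset μ r)) {R ε : ℝ} (hε : 0 < ε) (hεR : 6 * ε < R - r) :
    |∫ x in {x : E3 | r < ‖x‖ ∧ ‖x‖ < R}, rdiv Q x * (hcut r R ε ‖x‖ * (‖μ x‖ ^ 2 / ‖x‖ ^ 2))| ≤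
      2 * (l2LinfTail Q r * Real.sqrt C.toReal * Real.sqrt (Aint μ r * Msup μ r)) +
      2 * (l2LinfTail Q r * C.toReal * Real.sqrt 6 * (Msup μ r * (Real.sqrt (r + 1))⁻¹)) +
      2 * K / ε * l2LinfTail Q r * (C.toReal * (∫ t in r..(r + 3 * ε), sphAvg μ t) +
        C.toReal * (∫ t in (R - 3 * ε)..R, sphAvg μ t)) := by
  obtain ⟨hφ, hφs⟩ := phi_reg hr hμ (R := R) hε
  have hμc := hμ.continuousOn
  set S := {x : E3 | r < ‖x‖ ∧ ‖x‖ < R} with hS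
  set S1 := {x : E3 | r < ‖x‖ ∧ ‖x‖ < r + 3 * ε} with hS1
  set S2 := {x : E3 | R - 3 * ε < ‖x‖ ∧ ‖x‖ < R} with hS2
  set G : E3 → ℝ := fun x => ‖μ x‖ ^ 2 / ‖x‖ ^ 2 with hG
  set φ : E3 → ℝ := fun x => hcut r R ε ‖x‖ * G x with hφd
  set L := l2LinfTail Q r with hL
  have hL0 : 0 ≤ L := l2_nonneg _ _
  have hSm : MeasurableSet S := shell_meas r R
  have hS1m : MeasurableSet S1 := shell_meas _ _
  have hS2m : MeasurableSet S2 := shell_meas _ _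
  have hG0 : ∀ x, 0 ≤ G x := fun x => by positivity
  obtain ⟨i1, b1⟩ := interior1 hC1 hC hQ.continuous hs hr hμ hA hb R
  obtain ⟨i2, b2⟩ := interior2 hC1 hC hQ.continuous hs hr hμc hb R
  have hz : ∀ x, x ∉ S → φ =ᶠ[𝓝 x] fun _ => 0 := by
    intro x hx
    by_cases h1 : r < ‖x‖
    · have h2 : R - ε < ‖x‖ := by
        by_contra h
        exact hx ⟨h1, by linarith [not_lt.1 h]⟩
      filter_upwards [(isOpen_lt continuous_const continuous_norm).mem_nhds h2] with y hy
      have hy' : R - ε < ‖y‖ := hy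
      simp only [hφd]
      rw [hcut_zero_right hε hy'.le, zero_mul]
    · have h2 : ‖x‖ < r + ε := by linarith [not_lt.1 h1]
      filter_upwards [(isOpen_lt continuous_norm continuous_const).mem_nhds h2] with y hy
      have hy' : ‖y‖ < r + ε := hy
      simp only [hφd]
      rw [hcut_zero_left hε hy'.le, zero_mul]
  have e1 : ∫ x in S, rdiv Q x * φ x = ∫ x, rdiv Q x * φ x := by
    refine setIntegral_eq_integral_of_forall_compl_eq_zero fun x hx => ?_
    rw [(hz x hx).eq_of_nhds, mul_zero]
  have e2 : ∫ x in S, fderiv ℝ φ x (Q x) = ∫ x, fderiv ℝ φ x (Q x) := by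
    refine setIntegral_eq_integral_of_forall_compl_eq_zero fun x hx => ?_
    rw [(hz x hx).fderiv_eq]; simp
  change |∫ x in S, rdiv Q x * φ x| ≤ _
  rw [e1, ibp hQ hφ hφs, abs_neg, ← e2]
  have hGi : IntegrableOn G S := shell_integrableOn r R le_rfl (G_cont hr hμc)
  have hGi1 : IntegrableOn (S1.indicator G) S := hGi.indicator hS1m
  have hGi2 : IntegrableOn (S2.indicator G) S := hGi.indicator hS2m
  set B : E3 → ℝ := fun x => 2 * ((‖Q x‖ * ‖μ x‖ / ‖x‖) * (‖fderiv ℝ μ x‖ / ‖x‖)) +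
    2 * ((‖Q x‖ * ‖μ x‖ / ‖x‖) * (‖μ x‖ / ‖x‖ ^ 2)) +
    2 * K / ε * L * (S1.indicator G x + S2.indicator G x) with hB
  have hBi : IntegrableOn B S :=
    ((i1.const_mul 2).add (i2.const_mul 2)).add ((hGi1.add hGi2).const_mul _)
  have hpt : ∀ x ∈ S, |fderiv ℝ φ x (Q x)| ≤ B x := by
    intro x hx
    have hx0 : 0 < ‖x‖ := by linarith [hx.1]
    have hm : ContDiffAt ℝ 1 μ x := hμ.contDiffAt
        (mem_of_superset ((isOpen_lt continuous_const continuous_norm).mem_nhds hx.1)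
          fun y (hy : r < ‖y‖) => (le_of_lt hy : r ≤ ‖y‖))
    obtain ⟨d1, g1⟩ := G_fderiv hx0 (hm.differentiableAt one_ne_zero)
    obtain ⟨d2, g2⟩ := cut_fderiv r R ε hx0
    have hfd := fderiv_fun_mul d2 d1
    have hfd' : fderiv ℝ φ x (Q x) = hcut r R ε ‖x‖ * fderiv ℝ G x (Q x) +
        G x * fderiv ℝ (fun x : E3 => hcut r R ε ‖x‖) x (Q x) := by
      rw [show fderiv ℝ φ x = _ from hfd]
      simp [hG]
    rw [hfd']
    refine (abs_add_le _ _).trans ?_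
    rw [abs_mul, abs_mul, abs_of_nonneg (hcut_nonneg _ _ _ _), abs_of_nonneg (hG0 x)]
    have a1 : hcut r R ε ‖x‖ * |fderiv ℝ G x (Q x)| ≤
        2 * ((‖Q x‖ * ‖μ x‖ / ‖x‖) * (‖fderiv ℝ μ x‖ / ‖x‖)) +
        2 * ((‖Q x‖ * ‖μ x‖ / ‖x‖) * (‖μ x‖ / ‖x‖ ^ 2)) := by
      refine (mul_le_of_le_one_left (abs_nonneg _) (hcut_le_one _ _ _ _)).trans ((g1 (Q x)).trans (le_of_eq ?_))
      field_simp
    have a2 : G x * |fderiv ℝ (fun x : E3 => hcut r R ε ‖x‖) x (Q x)| ≤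
        2 * K / ε * L * (S1.indicator G x + S2.indicator G x) := by
      have q := Q_le_tail hQ.continuous hs hr x hx.1.le
      have n1 : 0 ≤ S1.indicator G x := indicator_nonneg (fun x _ => hG0 x) x
      have n2 : 0 ≤ S2.indicator G x := indicator_nonneg (fun x _ => hG0 x) x
      by_cases hm : x ∈ S1 ∨ x ∈ S2
      · have hGle : G x ≤ S1.indicator G x + S2.indicator G x := by
          rcases hm with h | h
          · rw [indicator_of_mem h]; linarith
          · rw [indicator_of_mem h (f := G) (s := S2)]; linarith
        have := hcut_deriv_le hK (r := r) (R := R) hε ‖x‖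
        calc G x * |fderiv ℝ (fun x : E3 => hcut r R ε ‖x‖) x (Q x)|
            ≤ (S1.indicator G x + S2.indicator G x) * (2 * K / ε * L) := by
              refine mul_le_mul hGle ((g2 _).trans ?_) (abs_nonneg _) (by positivity)
              gcongr
          _ = _ := by ring
      · rw [not_or] at hm
        have h1 : r + 3 * ε ≤ ‖x‖ := by
          by_contra h
          exact hm.1 ⟨hx.1, not_le.1 h⟩
        have h2 : ‖x‖ ≤ R - 3 * ε := by
          by_contra h
          exact hm.2 ⟨not_le.1 h, hx.2⟩
        have := g2 (Q x)
        rw [hcut_deriv_zero hε h1 h2, abs_zero, zero_mul] at this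
        rw [le_antisymm this (abs_nonneg _), mul_zero]
        positivity
    linarith
  have hint : |∫ x in S, fderiv ℝ φ x (Q x)| ≤ ∫ x in S, B x := by
    have := norm_integral_le_of_norm_le (f := fun x => fderiv ℝ φ x (Q x)) hBi ((ae_restrict_iff' hSm).2 (ae_of_all _ hpt))
    simpa using this
  refine hint.trans ?_
  have eB : ∫ x in S, B x = 2 * (∫ x in S, (‖Q x‖ * ‖μ x‖ / ‖x‖) * (‖fderiv ℝ μ x‖ / ‖x‖)) +
      2 * (∫ x in S, (‖Q x‖ * ‖μ x‖ / ‖x‖) * (‖μ x‖ / ‖x‖ ^ 2)) +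
      2 * K / ε * L * ((∫ x in S, S1.indicator G x) + ∫ x in S, S2.indicator G x) := by
    simp only [hB]
    have j1 : IntegrableOn (fun x => 2 * ((‖Q x‖ * ‖μ x‖ / ‖x‖) * (‖fderiv ℝ μ x‖ / ‖x‖))) S :=
      i1.const_mul 2
    have j2 : IntegrableOn (fun x => 2 * ((‖Q x‖ * ‖μ x‖ / ‖x‖) * (‖μ x‖ / ‖x‖ ^ 2))) S :=
      i2.const_mul 2
    have j12 : IntegrableOn (fun x => 2 * ((‖Q x‖ * ‖μ x‖ / ‖x‖) * (‖fderiv ℝ μ x‖ / ‖x‖)) +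
        2 * ((‖Q x‖ * ‖μ x‖ / ‖x‖) * (‖μ x‖ / ‖x‖ ^ 2))) S := j1.add j2
    have j3 : IntegrableOn (fun x => 2 * K / ε * L * (S1.indicator G x + S2.indicator G x)) S :=
      (hGi1.add hGi2).const_mul _
    rw [integral_add j12 j3, integral_add j1 j2, integral_const_mul, integral_const_mul,
      integral_const_mul, integral_add hGi1 hGi2]
  rw [eB]
  have l1 : ∫ x in S, S1.indicator G x ≤ C.toReal * ∫ t in r..(r + 3 * ε), sphAvg μ t := by
    rw [setIntegral_indicator hS1m, inter_eq_self_of_subset_right (s := S) (t := S1)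
      (fun x hx => ⟨hx.1, by linarith [hx.2]⟩)]
    exact shell_le hC1 hC hr hμc le_rfl (by linarith)
  have l2 : ∫ x in S, S2.indicator G x ≤ C.toReal * ∫ t in (R - 3 * ε)..R, sphAvg μ t := by
    rw [setIntegral_indicator hS2m, inter_eq_self_of_subset_right (s := S) (t := S2)
      (fun x hx => ⟨by linarith [hx.1], hx.2⟩)]
    exact shell_le hC1 hC hr hμc (by linarith) (by linarith)
  gcongr

lemma main_est {C : ℝ≥0∞} (hC1 : C ≠ ∞)
    (hC : (volume : Measure E3).toSphere ≤ C • (μH[2] : Measure (sphere (0 : E3) 1)))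
    {K : ℝ} (hK0 : 0 < K) (hK : ∀ t, |deriv Real.smoothTransition t| ≤ K)
    {Q : E3 → E3} (hQ : ContDiff ℝ 1 Q) (hs : Summable (fun n => (annSupV Q n) ^ 2))
    {r : ℝ} (hr : 1 ≤ r) {μ : E3 → ℂ} (hμ : ContDiffOn ℝ 1 μ {x : E3 | r ≤ ‖x‖})
    (hA : IntegrableOn (fun x : E3 => ‖fderiv ℝ μ x‖ ^ 2 / ‖x‖ ^ 2) {x : E3 | r < ‖x‖})
    (hb : BddAbove (Mset μ r)) {R : ℝ} (hR : r + 1 < R) {δ : ℝ} (hδ : 0 < δ) :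
    |∫ x in {x : E3 | r < ‖x‖ ∧ ‖x‖ < R}, rdiv Q x * ‖μ x‖ ^ 2 / ‖x‖ ^ 2| ≤
      2 * (l2LinfTail Q r * Real.sqrt C.toReal * Real.sqrt (Aint μ r * Msup μ r)) +
      2 * (l2LinfTail Q r * C.toReal * Real.sqrt 6 * (Msup μ r * (Real.sqrt (r + 1))⁻¹)) +
      6 * K * l2LinfTail Q r * (C.toReal * (sphAvg μ r + δ) + C.toReal * (sphAvg μ R + δ)) := by
  have hμc := hμ.continuousOn
  have hmc := sphAvg_continuousOn hr hμc
  have hL0 : 0 ≤ l2LinfTail Q r := l2_nonneg _ _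
  set S := {x : E3 | r < ‖x‖ ∧ ‖x‖ < R} with hS
  have hSm : MeasurableSet S := shell_meas r R
  have hdiv : Continuous (rdiv Q) := by
    unfold rdiv
    refine continuous_finsetSum _ fun i _ => ?_
    exact ((((contDiff_euclidean.1 hQ) i).continuous_fderiv one_ne_zero).clm_apply continuous_const)
  have hlim : Tendsto (fun ε : ℝ => ∫ x in S, rdiv Q x * (hcut r R ε ‖x‖ * (‖μ x‖ ^ 2 / ‖x‖ ^ 2)))
      (𝓝[>] 0) (𝓝 (∫ x in S, rdiv Q x * ‖μ x‖ ^ 2 / ‖x‖ ^ 2)) := by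
    have hcF : ContinuousOn (fun x => rdiv Q x * (‖μ x‖ ^ 2 / ‖x‖ ^ 2)) {x : E3 | r ≤ ‖x‖} :=
      hdiv.continuousOn.mul (G_cont hr hμc)
    have hFi : IntegrableOn (fun x => rdiv Q x * (‖μ x‖ ^ 2 / ‖x‖ ^ 2)) S :=
      shell_integrableOn r R le_rfl hcF
    refine tendsto_integral_filter_of_dominated_convergence
      (fun x => ‖rdiv Q x * (‖μ x‖ ^ 2 / ‖x‖ ^ 2)‖) ?_ ?_ hFi.norm ?_
    · refine Eventually.of_forall fun ε => ?_
      refine ContinuousOn.aestronglyMeasurable ?_ hSm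
      refine hdiv.continuousOn.mul (ContinuousOn.mul ?_ ((G_cont hr hμc).mono fun x hx => hx.1.le))
      exact ((hcut_contDiff r R ε).continuous.comp continuous_norm).continuousOn
    · refine Eventually.of_forall fun ε => ae_of_all _ fun x => ?_
      rw [norm_mul, norm_mul, norm_mul, Real.norm_of_nonneg (hcut_nonneg _ _ _ _)]
      gcongr
      exact mul_le_of_le_one_left (norm_nonneg _) (hcut_le_one _ _ _ _)
    · refine (ae_restrict_iff' hSm).2 (ae_of_all _ fun x hx => ?_)
      refine tendsto_const_nhds.congr' ?_
      have p1 : 0 < (‖x‖ - r) / 2 := by linarith [hx.1]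
      have p2 : 0 < (R - ‖x‖) / 2 := by linarith [hx.2]
      filter_upwards [Ioo_mem_nhdsGT (lt_min p1 p2)] with ε hε
      have q1 := hε.2.trans_le (min_le_left _ _)
      have q2 := hε.2.trans_le (min_le_right _ _)
      rw [hcut_one hε.1 (by linarith) (by linarith), one_mul, mul_div_assoc]
  refine le_of_tendsto hlim.abs ?_
  have c1 : ∀ᶠ ε : ℝ in 𝓝[>] 0, ∀ t ∈ Icc r (r + 3 * ε), sphAvg μ t ≤ sphAvg μ r + δ := by
    obtain ⟨η, hη, h⟩ := Metric.continuousWithinAt_iff.1 (hmc r self_mem_Ici) δ hδ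
    filter_upwards [Ioo_mem_nhdsGT (show 0 < η / 3 by positivity)] with ε hε t ht
    have := h (x := t) (mem_Ici.2 ht.1) (by rw [Real.dist_eq, abs_lt]; constructor <;> linarith [ht.1, ht.2, hε.1, hε.2])
    rw [Real.dist_eq, abs_lt] at this
    linarith [this.2]
  have c2 : ∀ᶠ ε : ℝ in 𝓝[>] 0, ∀ t ∈ Icc (R - 3 * ε) R, sphAvg μ t ≤ sphAvg μ R + δ := by
    obtain ⟨η, hη, h⟩ := Metric.continuousWithinAt_iff.1 (hmc R (mem_Ici.2 (by linarith))) δ hδ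
    filter_upwards [Ioo_mem_nhdsGT (show 0 < η / 3 by positivity),
      Ioo_mem_nhdsGT (show (0 : ℝ) < 1 / 3 by positivity)] with ε hε hε' t ht
    have := h (x := t) (mem_Ici.2 (by linarith [ht.1, hε'.2]))
      (by rw [Real.dist_eq, abs_lt]; constructor <;> linarith [ht.1, ht.2, hε.1, hε.2])
    rw [Real.dist_eq, abs_lt] at this
    linarith [this.2]
  have c3 : (0 : ℝ) < (R - r) / 6 := by linarith
  filter_upwards [c1, c2, Ioo_mem_nhdsGT c3] with ε h1 h2 hε
  have hε0 : 0 < ε := hε.1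
  have hε6 : 6 * ε < R - r := by linarith [hε.2]
  refine (fixed_eps hC1 hC hK0 hK hQ hs hr hμ hA hb hε0 hε6).trans ?_
  have hint : ∀ a b, r ≤ a → a ≤ b → IntervalIntegrable (sphAvg μ) volume a b := fun a b hra hab =>
    ContinuousOn.intervalIntegrable (hmc.mono (by rw [uIcc_of_le hab]; exact fun t ht => hra.trans ht.1))
  have u1 : ∫ t in r..(r + 3 * ε), sphAvg μ t ≤ 3 * ε * (sphAvg μ r + δ) := by
    have := intervalIntegral.integral_mono_on (by linarith : r ≤ r + 3 * ε)
      (hint _ _ le_rfl (by linarith)) (intervalIntegrable_const (c := sphAvg μ r + δ)) h1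
    simpa [mul_add] using this
  have u2 : ∫ t in (R - 3 * ε)..R, sphAvg μ t ≤ 3 * ε * (sphAvg μ R + δ) := by
    have := intervalIntegral.integral_mono_on (by linarith : R - 3 * ε ≤ R)
      (hint _ _ (by linarith) (by linarith)) (intervalIntegrable_const (c := sphAvg μ R + δ)) h2
    simpa [mul_add] using this
  have hc0 : 0 ≤ C.toReal := ENNReal.toReal_nonneg
  have : 2 * K / ε * l2LinfTail Q r * (C.toReal * (∫ t in r..(r + 3 * ε), sphAvg μ t) +
        C.toReal * (∫ t in (R - 3 * ε)..R, sphAvg μ t)) ≤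
      2 * K / ε * l2LinfTail Q r * (C.toReal * (3 * ε * (sphAvg μ r + δ)) +
        C.toReal * (3 * ε * (sphAvg μ R + δ))) := by
    gcongr
  refine (add_le_add le_rfl this).trans (le_of_eq ?_)
  congr 1
  field_simp
  ring


end Aux

/-- Bound on `|∫_{r<|x|<R} (div Q) |μ|²/|x|² dx|` in terms of the tail
norm `‖Q‖_{ℓ²([r],∞),L∞}` and the quantities `m, A(r), M(r)`, with an absolute constant. -/
theorem stmt_12 :
    ∃ C : ℝ, 0 < C ∧
      ∀ Q : EuclideanSpace ℝ (Fin 3) → EuclideanSpace ℝ (Fin 3),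
        ContDiff ℝ 1 Q → Summable (fun n => (annSupV Q n) ^ 2) →
        ∀ r : ℝ, 1 ≤ r →
          ∀ μ : EuclideanSpace ℝ (Fin 3) → ℂ,
            ContDiffOn ℝ 1 μ {x : EuclideanSpace ℝ (Fin 3) | r ≤ ‖x‖} →
            IntegrableOn (fun x : EuclideanSpace ℝ (Fin 3) => ‖fderiv ℝ μ x‖ ^ 2 / ‖x‖ ^ 2)
              {x : EuclideanSpace ℝ (Fin 3) | r < ‖x‖} →
            BddAbove (Mset μ r) →
            ∀ R : ℝ, r + 1 < R →
              |∫ x in {x : EuclideanSpace ℝ (Fin 3) | r < ‖x‖ ∧ ‖x‖ < R},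
                  rdiv Q x * ‖μ x‖ ^ 2 / ‖x‖ ^ 2| ≤
                C * l2LinfTail Q r *
                  (sphAvg μ r + sphAvg μ R + Real.sqrt (Aint μ r * Msup μ r)
                    + Msup μ r * (Real.sqrt (r + 1))⁻¹) := by
  obtain ⟨C, _, hC1, hC⟩ := toSphere_le
  obtain ⟨K, hK0, hK⟩ := eta_deriv_bound
  have hc0 : 0 ≤ C.toReal := ENNReal.toReal_nonneg
  have hs6 := Real.sqrt_nonneg (6 : ℝ)
  have hsc := Real.sqrt_nonneg C.toReal
  refine ⟨6 * K * C.toReal + 2 * Real.sqrt C.toReal + 2 * Real.sqrt 6 * C.toReal + 1, by positivity, ?_⟩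
  intro Q hQ hs r hr μ hμ hA hb R hR
  have hL0 : 0 ≤ l2LinfTail Q r := l2_nonneg _ _
  have hm := sphAvg_nonneg μ r
  have hmR := sphAvg_nonneg μ R
  have hM := Msup_nonneg hr hμ.continuousOn hb
  set a := Real.sqrt (Aint μ r * Msup μ r) with ha
  have ha0 : 0 ≤ a := Real.sqrt_nonneg _
  set b := Msup μ r * (Real.sqrt (r + 1))⁻¹ with hbd
  have hb0 : 0 ≤ b := by positivity
  set L := l2LinfTail Q r
  have key : |∫ x in {x : EuclideanSpace ℝ (Fin 3) | r < ‖x‖ ∧ ‖x‖ < R},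
      rdiv Q x * ‖μ x‖ ^ 2 / ‖x‖ ^ 2| ≤ 2 * (L * Real.sqrt C.toReal * a) +
      2 * (L * C.toReal * Real.sqrt 6 * b) +
      6 * K * L * (C.toReal * sphAvg μ r + C.toReal * sphAvg μ R) := by
    refine le_of_forall_pos_le_add fun η hη => ?_
    have hD : 0 < 12 * K * L * C.toReal + 1 := by positivity
    have h := main_est hC1 hC hK0 hK hQ hs hr hμ hA hb hR (div_pos hη hD)
    refine h.trans ?_
    have : 12 * K * L * C.toReal * (η / (12 * K * L * C.toReal + 1)) ≤ η := by
      rw [mul_div_assoc', div_le_iff₀ hD]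
      nlinarith
    simp only [← ha, ← hbd]
    linarith
  refine key.trans ?_
  have t1 : 0 ≤ Real.sqrt C.toReal * L := by positivity
  have t2 : 0 ≤ Real.sqrt 6 * C.toReal * L := by positivity
  have t3 : 0 ≤ K * C.toReal * L := by positivity
  have hsum : 0 ≤ sphAvg μ r + sphAvg μ R := by linarith
  have w1 := mul_nonneg t1 hsum
  have w2 := mul_nonneg t1 hb0
  have w3 := mul_nonneg t2 hsum
  have w4 := mul_nonneg t2 ha0
  have w5 := mul_nonneg t3 ha0
  have w6 := mul_nonneg t3 hb0
  have w7 := mul_nonneg hL0 hsum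
  have w8 := mul_nonneg hL0 ha0
  have w9 := mul_nonneg hL0 hb0
  nlinarith
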